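/- arXiv:1706.10256 — 9 statements merged into one kernel-verified Lean document; each statement's English description precedes it below -/
import Mathlib

section
/- Let P be a nonempty finite set of points in Euclidean space ℝⁿ, let x ∈ ℝⁿ and r ≥ 0 be such that the ball B(x,r) covers P, and let S = {p ∈ P : ‖p − x‖ = r} be the set of points of P lying on the boundary of B(x,r). Then B(x,r) is a minimum covering ball of P if and only if x belongs to the convex hull of S. -/
section CoveringBall

open Filter Topology

variable {E : Type*} [NormedAddCommGroup E] [InnerProductSpace ℝ E]

/-- A point of the convex hull of `s` is not strictly separated from `s` by a hyperplane
through it. -/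
theorem exists_inner_sub_nonpos_of_mem_convexHull {s : Set E} {x : E}
    (hx : x ∈ convexHull ℝ s) (v : E) : ∃ p ∈ s, inner ℝ v (p - x) ≤ 0 := by
  by_contra! h
  have hconv : Convex ℝ {p : E | inner ℝ v x < inner ℝ v p} :=
    convex_halfSpace_gt (innerSL ℝ v).toLinearMap.isLinear _
  have hsub : s ⊆ {p : E | inner ℝ v x < inner ℝ v p} := fun p hp => by
    have := h p hp
    rw [inner_sub_right] at this
    simpa using this
  exact lt_irrefl (inner ℝ v x) (convexHull_min hsub hconv hx)

/-- A point outside a closed convex set is strictly separated from it by a hyperplane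
through the point. -/
theorem exists_forall_inner_sub_pos_of_notMem [CompleteSpace E] {s : Set E} {x : E}
    (hs : Convex ℝ s) (hc : IsClosed s) (hx : x ∉ s) :
    ∃ v : E, ∀ p ∈ s, 0 < inner ℝ v (p - x) := by
  obtain ⟨f, u, hfx, hf⟩ := geometric_hahn_banach_point_closed hs hc hx
  refine ⟨(InnerProductSpace.toDual ℝ E).symm f, fun p hp => ?_⟩
  rw [InnerProductSpace.toDual_symm_apply, map_sub, sub_pos]
  exact hfx.trans (hf p hp)

theorem norm_sub_le_norm_sub_of_inner_nonpos {p x y : E}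
    (h : inner ℝ (y - x) (p - x) ≤ 0) : ‖p - x‖ ≤ ‖p - y‖ := by
  have key := norm_sub_sq_real (p - x) (y - x)
  rw [sub_sub_sub_cancel_right, real_inner_comm] at key
  refine (pow_le_pow_iff_left₀ (norm_nonneg _) (norm_nonneg _) two_ne_zero).1 ?_
  nlinarith [sq_nonneg ‖y - x‖]

theorem eventually_norm_sub_add_smul_lt_of_inner_pos {p x v : E}
    (h : 0 < inner ℝ v (p - x)) : ∀ᶠ t : ℝ in 𝓝[>] 0, ‖p - (x + t • v)‖ < ‖p - x‖ := by
  have hlim : Tendsto (fun t : ℝ => t * ‖v‖ ^ 2 - 2 * inner ℝ v (p - x)) (𝓝[>] 0)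
      (𝓝 (0 * ‖v‖ ^ 2 - 2 * inner ℝ v (p - x))) :=
    (Continuous.tendsto (by fun_prop) 0).mono_left nhdsWithin_le_nhds
  filter_upwards [hlim.eventually_lt_const (show _ < (0 : ℝ) by linarith),
    self_mem_nhdsWithin] with t ht ht0
  have ht0 : 0 < t := ht0
  have key := norm_sub_sq_real (p - x) (t • v)
  rw [sub_sub, inner_smul_right, real_inner_comm, norm_smul, mul_pow, Real.norm_eq_abs,
    sq_abs] at key
  refine lt_of_pow_lt_pow_left₀ 2 (norm_nonneg _) ?_
  nlinarith [mul_neg_of_pos_of_neg ht0 ht]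

theorem eventually_norm_sub_add_smul_lt {p x v : E} {r : ℝ} (h : ‖p - x‖ < r) :
    ∀ᶠ t : ℝ in 𝓝[>] 0, ‖p - (x + t • v)‖ < r := by
  have hlim : Tendsto (fun t : ℝ => ‖p - (x + t • v)‖) (𝓝[>] 0)
      (𝓝 ‖p - (x + (0 : ℝ) • v)‖) :=
    (Continuous.tendsto (by fun_prop) 0).mono_left nhdsWithin_le_nhds
  exact hlim.eventually_lt_const (by simpa using h)

end CoveringBall

/-- If a ball `B(x,r)` covers a nonempty finite set `P`, and `S` is the set of points of
`P` on its boundary, then `B(x,r)` is a minimum covering ball of `P` iff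
`x ∈ conv S`. -/
theorem stmt0 {n : ℕ} (P : Finset (EuclideanSpace ℝ (Fin n))) (hP : P.Nonempty)
    (x : EuclideanSpace ℝ (Fin n)) (r : ℝ) (hr : 0 ≤ r)
    (hcov : ∀ p ∈ P, ‖p - x‖ ≤ r) :
    (∀ (y : EuclideanSpace ℝ (Fin n)) (r' : ℝ), (∀ p ∈ P, ‖p - y‖ ≤ r') → r ≤ r') ↔
      x ∈ convexHull ℝ {p : EuclideanSpace ℝ (Fin n) | p ∈ P ∧ ‖p - x‖ = r} := by
  constructor
  · intro hmin
    by_contra hx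
    have hfin : {p : EuclideanSpace ℝ (Fin n) | p ∈ P ∧ ‖p - x‖ = r}.Finite :=
      P.finite_toSet.subset fun p hp => hp.1
    obtain ⟨v, hv⟩ := exists_forall_inner_sub_pos_of_notMem (convex_convexHull ℝ _)
      (hfin.isClosed_convexHull ℝ) hx
    have hev : ∀ᶠ t : ℝ in nhdsWithin 0 (Set.Ioi 0), ∀ p ∈ P, ‖p - (x + t • v)‖ < r := by
      rw [Filter.eventually_all_finset]
      intro p hp
      rcases (hcov p hp).lt_or_eq with hlt | heq
      · exact eventually_norm_sub_add_smul_lt hlt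
      · have hpos := hv p (subset_convexHull ℝ _ ⟨hp, heq⟩)
        simpa only [heq] using eventually_norm_sub_add_smul_lt_of_inner_pos hpos
    obtain ⟨t, ht⟩ := hev.exists
    exact (hmin (x + t • v) (P.sup' hP fun p => ‖p - (x + t • v)‖) fun p hp =>
      Finset.le_sup' (fun p => ‖p - (x + t • v)‖) hp).not_gt ((Finset.sup'_lt_iff hP).2 ht)
  · intro hx y r' hy
    obtain ⟨p, ⟨hp, rfl⟩, hinner⟩ := exists_inner_sub_nonpos_of_mem_convexHull hx (y - x)
    exact (norm_sub_le_norm_sub_of_inner_nonpos hinner).trans (hy p hp)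
end

section
/- Let p_1, …, p_{s−1} be affinely independent points in ℝⁿ, and let x' = Σ_j π_j p_j with Σ_j π_j = 1 and p' = Σ_j ω_j p_j with Σ_j ω_j = 1 be points of their affine span written in affine coordinates. If x' lies in the convex hull of {p_1, …, p_{s−1}} ∪ {p'}, then for every index j, π_j < 0 implies ω_j < 0. -/
/-- Affine coordinates with respect to an affinely independent family are unique. -/
theorem AffineIndependent.weights_eq_of_sum_smul_eq {ι V : Type*} [Fintype ι] [AddCommGroup V]
    [Module ℝ V] {p : ι → V} (hp : AffineIndependent ℝ p) {v w : ι → ℝ}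
    (hsum : ∑ i, v i = ∑ i, w i) (h : ∑ i, v i • p i = ∑ i, w i • p i) : v = w := by
  funext i
  refine sub_eq_zero.mp
    (affineIndependent_iff.mp hp Finset.univ (fun i => v i - w i) ?_ ?_ i (Finset.mem_univ i))
  · rw [Finset.sum_sub_distrib, hsum, sub_self]
  · simp only [sub_smul, Finset.sum_sub_distrib, h, sub_self]

/-- The affine combinations whose `j`-th weight is nonnegative form a convex set. -/
theorem convex_setOf_sum_smul_nonneg {ι V : Type*} [Fintype ι] [AddCommGroup V] [Module ℝ V]
    (p : ι → V) (j : ι) :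
    Convex ℝ {x : V | ∃ w : ι → ℝ, ∑ i, w i = 1 ∧ 0 ≤ w j ∧ ∑ i, w i • p i = x} := by
  rintro _ ⟨v, hv, hvj, rfl⟩ _ ⟨w, hw, hwj, rfl⟩ a b ha hb hab
  refine ⟨fun i => a * v i + b * w i, ?_, by positivity, ?_⟩
  · rw [Finset.sum_add_distrib, ← Finset.mul_sum, ← Finset.mul_sum, hv, hw, mul_one, mul_one, hab]
  · simp only [add_smul, mul_smul, Finset.sum_add_distrib, Finset.smul_sum]

/-- Lemma 2 of the paper: with `x' = Σ πⱼ pⱼ` and `p' = Σ ωⱼ pⱼ` affine combinations of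
affinely independent points, if `x' ∈ conv ({p₁,…} ∪ {p'})` then `πⱼ < 0` implies `ωⱼ < 0`. -/
theorem stmt4 {n m : ℕ} (p : Fin m → EuclideanSpace ℝ (Fin n))
    (hindep : AffineIndependent ℝ p)
    (π ω : Fin m → ℝ) (hπ1 : ∑ j, π j = 1) (hω1 : ∑ j, ω j = 1)
    (x' p' : EuclideanSpace ℝ (Fin n))
    (hx' : x' = ∑ j, π j • p j) (hp' : p' = ∑ j, ω j • p j)
    (hconv : x' ∈ convexHull ℝ (Set.range p ∪ {p'})) :
    ∀ j, π j < 0 → ω j < 0 := by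
  intro j hj
  by_contra! hω
  have hsub : Set.range p ∪ {p'} ⊆
      {x | ∃ w : Fin m → ℝ, ∑ i, w i = 1 ∧ 0 ≤ w j ∧ ∑ i, w i • p i = x} := by
    rintro _ (⟨k, rfl⟩ | rfl)
    · refine ⟨Pi.single k 1, by simp, ?_, by simp [Pi.single_apply]⟩
      exact (Pi.single_nonneg.mpr zero_le_one : (0 : Fin m → ℝ) ≤ Pi.single k 1) j
    · exact ⟨ω, hω1, hω, hp'.symm⟩
  obtain ⟨w, hw1, hwj, hw⟩ := convexHull_min hsub (convex_setOf_sum_smul_nonneg p j) hconv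
  have hwπ : w = π := hindep.weights_eq_of_sum_smul_eq (hw1.trans hπ1.symm) (hw.trans hx')
  exact hj.not_ge (hwπ ▸ hwj)
end

section
/- Let p_1, …, p_{s−1} be affinely independent points in ℝⁿ, and let x' = Σ_j π_j p_j with Σ_j π_j = 1 and p' = Σ_j ω_j p_j with Σ_j ω_j = 1 be points of their affine span written in affine coordinates. If x' lies in the convex hull of {p_1, …, p_{s−1}} ∪ {p'}, then there exists an index j with ω_j > 0 and π_j ≥ 0. -/
/-- The affine combinations of a family of points whose `j`-th weight is nonnegative form a
convex set. -/
theorem convex_image_affineCombination_nonneg {ι E : Type*} [Fintype ι] [AddCommGroup E]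
    [Module ℝ E] (p : ι → E) (j : ι) :
    Convex ℝ (Fintype.linearCombination ℝ p '' {w | ∑ i, w i = 1 ∧ 0 ≤ w j}) := by
  refine Convex.linear_image ?_ _
  rintro v ⟨hv, hvj⟩ w ⟨hw, hwj⟩ a b ha hb hab
  refine ⟨?_, ?_⟩
  · simp [Finset.sum_add_distrib, ← Finset.mul_sum, hv, hw, hab]
  · simp only [Pi.add_apply, Pi.smul_apply, smul_eq_mul]
    positivity

/-- Weights of equal sum that represent the same point with respect to an affinely independent
family are equal. -/
theorem AffineIndependent.weights_eq {ι E : Type*} [Fintype ι] [AddCommGroup E] [Module ℝ E]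
    {p : ι → E} (hp : AffineIndependent ℝ p) {v w : ι → ℝ} (hsum : ∑ i, v i = ∑ i, w i)
    (h : ∑ i, v i • p i = ∑ i, w i • p i) : v = w := by
  funext i
  refine sub_eq_zero.1 (affineIndependent_iff.1 hp Finset.univ (fun i => v i - w i) ?_ ?_ i
    (Finset.mem_univ i))
  · simp [Finset.sum_sub_distrib, hsum]
  · simp [sub_smul, Finset.sum_sub_distrib, h]

/-- With `x' = Σ πⱼ pⱼ` and `p' = Σ ωⱼ pⱼ` affine combinations of affinely independent
points, if `x' ∈ conv ({p₁,…} ∪ {p'})` then some index satisfies `ωⱼ > 0` and `πⱼ ≥ 0`. -/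
theorem stmt5 {n m : ℕ} (p : Fin m → EuclideanSpace ℝ (Fin n))
    (hindep : AffineIndependent ℝ p)
    (π ω : Fin m → ℝ) (hπ1 : ∑ j, π j = 1) (hω1 : ∑ j, ω j = 1)
    (x' p' : EuclideanSpace ℝ (Fin n))
    (hx' : x' = ∑ j, π j • p j) (hp' : p' = ∑ j, ω j • p j)
    (hconv : x' ∈ convexHull ℝ (Set.range p ∪ {p'})) :
    ∃ j, 0 < ω j ∧ 0 ≤ π j := by
  obtain ⟨j, -, hj⟩ : ∃ j ∈ Finset.univ, 0 < ω j :=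
    Finset.exists_lt_of_sum_lt (f := fun _ => (0 : ℝ)) (by simp [hω1])
  refine ⟨j, hj, ?_⟩
  have hsub : Set.range p ∪ {p'} ⊆
      Fintype.linearCombination ℝ p '' {w | ∑ i, w i = 1 ∧ 0 ≤ w j} := by
    rintro _ (⟨i, rfl⟩ | rfl)
    · refine ⟨Pi.single i 1, ⟨by simp, ?_⟩, by simp⟩
      exact (Pi.single_nonneg.2 zero_le_one : (0 : Fin m → ℝ) ≤ Pi.single i 1) j
    · exact ⟨ω, ⟨hω1, hj.le⟩, by rw [hp', Fintype.linearCombination_apply]⟩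
  obtain ⟨w, ⟨hw1, hwj⟩, hw⟩ :=
    convexHull_min hsub (convex_image_affineCombination_nonneg p j) hconv
  rw [Fintype.linearCombination_apply, hx'] at hw
  rwa [← hindep.weights_eq (hw1.trans hπ1.symm) hw]
end

section
/- Let S = {p_1, …, p_{s−1}, p} be an affinely independent set in ℝⁿ with s ≥ 2, and set S' = {p_1, …, p_{s−1}}. Let x be a point in the convex hull of S, and let d ∈ ℝⁿ be a vector lying in the direction space of the affine span of S, satisfying ⟨p_j − p_{s−1}, d⟩ = 0 for all j = 1, …, s−2 and ⟨p − p_{s−1}, d⟩ = 1. Let x' and p' be the orthogonal projections of x and p onto the affine span of S'. Then for any k ∈ {1, …, s−1}, the line ℓ = {x + αd : α ∈ ℝ} intersects the facet F_k = conv(S \ {p_k}) if and only if x' lies in the convex hull of (S' \ {p_k}) ∪ {p'}. -/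
open RealInnerProductSpace

/-- The residual of a nearest point in an affine subspace is orthogonal to its direction. -/
theorem inner_sub_eq_zero_of_forall_dist_le {E : Type*} [NormedAddCommGroup E]
    [InnerProductSpace ℝ E] {A : AffineSubspace ℝ E} {z z' : E} (hmem : z' ∈ A)
    (hnear : ∀ y ∈ A, dist z z' ≤ dist z y) {u : E} (hu : u ∈ A.direction) :
    ⟪u, z - z'⟫ = 0 := by
  rcases eq_or_ne u 0 with rfl | hu0
  · simp
  have hpos : 0 < ⟪u, u⟫ := real_inner_self_pos.2 hu0
  set s : ℝ := ⟪u, z - z'⟫ / ⟪u, u⟫ with hs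
  have h := hnear (s • u +ᵥ z') (AffineSubspace.vadd_mem_of_mem_direction
    (A.direction.smul_mem s hu) hmem)
  rw [dist_eq_norm, dist_eq_norm, vadd_eq_add,
    show z - (s • u + z') = (z - z') - s • u by abel] at h
  have h2 := mul_self_le_mul_self (norm_nonneg _) h
  rw [← real_inner_self_eq_norm_mul_norm, ← real_inner_self_eq_norm_mul_norm,
    real_inner_sub_sub_self (z - z') (s • u), real_inner_smul_left, real_inner_smul_right,
    real_inner_smul_right, real_inner_comm u (z - z')] at h2
  have h3 : s * ⟪u, u⟫ = ⟪u, z - z'⟫ := by rw [hs]; field_simp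
  have h4 : s * (s * ⟪u, u⟫) ≤ 0 := by
    have h5 : s * ⟪u, z - z'⟫ = s * (s * ⟪u, u⟫) := by rw [h3]
    linarith
  have h6 : s = 0 := by
    by_contra hne
    have : 0 < s * s := mul_self_pos.2 hne
    nlinarith
  rw [← h3, h6, zero_mul]

/-- Adjoining one point `p` to a set enlarges the direction of its affine span by at most the
line through `p` and any point `p'` of that affine span. -/
theorem vectorSpan_union_singleton_le {V : Type*} [AddCommGroup V] [Module ℝ V] {s : Set V}
    {p p' : V} (hp' : p' ∈ affineSpan ℝ s) :
    vectorSpan ℝ (s ∪ {p}) ≤ vectorSpan ℝ s ⊔ Submodule.span ℝ {p - p'} := by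
  obtain ⟨a, ha⟩ : s.Nonempty := (affineSpan_nonempty ℝ).1 ⟨p', hp'⟩
  rw [vectorSpan_eq_span_vsub_set_right ℝ (Set.mem_union_left {p} ha), Submodule.span_le]
  rintro _ ⟨b, hb | rfl, rfl⟩
  · exact Submodule.mem_sup_left (vsub_mem_vectorSpan ℝ hb ha)
  · have h : p' - a ∈ vectorSpan ℝ s := by
      rw [← direction_affineSpan]
      exact AffineSubspace.vsub_mem_direction hp' (mem_affineSpan ℝ ha)
    have := Submodule.add_mem_sup h (Submodule.mem_span_singleton_self (R := ℝ) (b - p'))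
    simpa using this

/-- Lemma 3 of the paper: the line `ℓ = {x + αd}` intersects the facet
`F_k = conv (S \ {p_k})` iff the projection `x'` of `x` onto `aff S'` lies in
`conv ((S' \ {p_k}) ∪ {p'})`, where `p'` is the projection of `p`. -/
theorem stmt6 {n k : ℕ} (q : Fin (k + 1) → EuclideanSpace ℝ (Fin n))
    (p : EuclideanSpace ℝ (Fin n))
    (hindep : AffineIndependent ℝ (Fin.snoc q p : Fin (k + 2) → EuclideanSpace ℝ (Fin n)))
    (x : EuclideanSpace ℝ (Fin n))
    (hx : x ∈ convexHull ℝ (Set.range q ∪ {p}))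
    (d : EuclideanSpace ℝ (Fin n))
    (hd : d ∈ (affineSpan ℝ (Set.range q ∪ {p})).direction)
    (hdperp : ∀ j, ⟪q j - q (Fin.last k), d⟫ = 0)
    (hdp : ⟪p - q (Fin.last k), d⟫ = 1)
    (x' p' : EuclideanSpace ℝ (Fin n))
    (hx'mem : x' ∈ affineSpan ℝ (Set.range q))
    (hx'near : ∀ y ∈ affineSpan ℝ (Set.range q), dist x x' ≤ dist x y)
    (hp'mem : p' ∈ affineSpan ℝ (Set.range q))
    (hp'near : ∀ y ∈ affineSpan ℝ (Set.range q), dist p p' ≤ dist p y)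
    (kk : Fin (k + 1)) :
    (∃ α : ℝ, x + α • d ∈ convexHull ℝ ((Set.range q \ {q kk}) ∪ {p})) ↔
      x' ∈ convexHull ℝ ((Set.range q \ {q kk}) ∪ {p'}) := by
  set c := q (Fin.last k)
  set w := p - p' with hw
  have hq (j : Fin (k + 1)) : q j ∈ affineSpan ℝ (Set.range q) :=
    mem_affineSpan ℝ (Set.mem_range_self j)
  have hVd : ∀ u ∈ vectorSpan ℝ (Set.range q), ⟪d, u⟫ = 0 := by
    intro u hu
    rw [vectorSpan_range_eq_span_range_vsub_right ℝ q (Fin.last k)] at hu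
    induction hu using Submodule.span_induction with
    | mem u hu =>
      obtain ⟨j, rfl⟩ := hu
      rw [real_inner_comm]
      exact hdperp j
    | zero => simp
    | add u v _ _ hu hv => rw [inner_add_right, hu, hv, add_zero]
    | smul r u _ hu => rw [real_inner_smul_right, hu, mul_zero]
  have hVsub {y : EuclideanSpace ℝ (Fin n)} (hy : y ∈ affineSpan ℝ (Set.range q)) :
      ⟪d, y⟫ = ⟪d, c⟫ := by
    rw [← sub_eq_zero, ← inner_sub_right]
    apply hVd
    rw [← direction_affineSpan]
    exact AffineSubspace.vsub_mem_direction hy (hq _)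
  have hpd : ⟪d, p⟫ = 1 + ⟪d, c⟫ := by
    rw [← hdp, real_inner_comm d (p - c), inner_sub_right]
    ring
  have hwd : ⟪d, w⟫ = 1 := by rw [hw, inner_sub_right, hVsub hp'mem, hpd]; ring
  have hline : ∀ v ∈ vectorSpan ℝ (Set.range q ∪ {p}),
      (∀ u ∈ vectorSpan ℝ (Set.range q), ⟪u, v⟫ = 0) → v = ⟪d, v⟫ • w := by
    intro v hv hperp
    obtain ⟨u, hu, y, hy, rfl⟩ := Submodule.mem_sup.1 (vectorSpan_union_singleton_le hp'mem hv)
    obtain ⟨r, rfl⟩ := Submodule.mem_span_singleton.1 hy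
    have h1 := hperp u hu
    have h2 : ⟪u, w⟫ = 0 := inner_sub_eq_zero_of_forall_dist_le hp'mem hp'near
      (by rwa [direction_affineSpan])
    rw [← hw, inner_add_right, real_inner_smul_right, h2, mul_zero, add_zero,
      inner_self_eq_zero] at h1
    rw [← hw, h1, zero_add, real_inner_smul_right, hwd, mul_one]
  have hdw : d = ⟪d, d⟫ • w :=
    hline d (by rwa [direction_affineSpan] at hd) fun u hu ↦ by rw [real_inner_comm, hVd u hu]
  have hdd : ⟪d, d⟫ ≠ 0 := by
    intro h
    rw [inner_self_eq_zero] at h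
    simp [h] at hwd
  have hxw : x - x' = ⟪d, x - x'⟫ • w := by
    refine hline _ ?_ fun u hu ↦ inner_sub_eq_zero_of_forall_dist_le hx'mem hx'near
      (by rwa [direction_affineSpan])
    rw [← direction_affineSpan]
    exact AffineSubspace.vsub_mem_direction (convexHull_subset_affineSpan _ hx)
      (affineSpan_mono ℝ Set.subset_union_left hx'mem)
  let π : EuclideanSpace ℝ (Fin n) →ᵃ[ℝ] EuclideanSpace ℝ (Fin n) :=
    (LinearMap.id - (innerSL ℝ d).toLinearMap.smulRight w).toAffineMap +
      AffineMap.const ℝ _ (⟪d, c⟫ • w)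
  have hπ (z : EuclideanSpace ℝ (Fin n)) : π z = z - ⟪d, z⟫ • w + ⟪d, c⟫ • w := by
    simp [π]
  have hπq (j : Fin (k + 1)) : π (q j) = q j := by rw [hπ, hVsub (hq j)]; abel
  have hπp : π p = p' := by rw [hπ, hpd, add_smul, one_smul, hw]; abel
  have hπx : π x = x' := by
    rw [inner_sub_right, hVsub hx'mem, sub_smul] at hxw
    rw [hπ, ← sub_eq_zero, ← sub_eq_zero.2 hxw]
    abel
  have himage : π '' (Set.range q \ {q kk} ∪ {p}) = Set.range q \ {q kk} ∪ {p'} := by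
    rw [Set.image_union, Set.image_singleton, hπp]
    congr 1
    refine (Set.image_congr ?_).trans (Set.image_id _)
    rintro _ ⟨⟨j, rfl⟩, -⟩
    exact hπq j
  rw [← himage, ← AffineMap.image_convexHull, ← hπx]
  constructor
  · rintro ⟨α, h⟩
    refine ⟨_, h, ?_⟩
    rw [hπ, hπ, inner_add_right, real_inner_smul_right, add_smul, mul_smul, ← hdw]
    abel
  · rintro ⟨z, hz, h⟩
    refine ⟨(⟪d, z⟫ - ⟪d, x⟫) / ⟪d, d⟫, ?_⟩
    convert hz using 1
    rw [hπ, hπ, add_left_inj] at h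
    have hw' : w = ⟪d, d⟫⁻¹ • d := by
      rw [eq_inv_smul_iff₀ hdd, ← hdw]
    rw [div_eq_mul_inv, mul_smul, ← hw', sub_smul, ← sub_eq_zero, ← sub_eq_zero.2 h.symm]
    abel
end

section
/- Let S = {p_1, …, p_{s−1}, p} be an affinely independent set in ℝⁿ with s ≥ 2, set S' = {p_1, …, p_{s−1}}, and let x be a point in the convex hull of S. Let x' and p' be the orthogonal projections of x and p onto the affine span of S', with affine coordinates x' = Σ_j π_j p_j (Σ_j π_j = 1) and p' = Σ_j ω_j p_j (Σ_j ω_j = 1) with respect to p_1, …, p_{s−1}. If for some index k one has π_k = 0 and ω_k = 0, then x lies in the convex hull of S \ {p_k} = (S' \ {p_k}) ∪ {p}; in particular, the ray from x intersects the facet conv(S \ {p_k}) at α = 0. -/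
/-- A point of an affine subspace nearest to `z` is the orthogonal projection of `z`. -/
theorem eq_orthogonalProjection_of_forall_dist_le {V P : Type*} [NormedAddCommGroup V]
    [InnerProductSpace ℝ V] [MetricSpace P] [NormedAddTorsor V P] {s : AffineSubspace ℝ P}
    [Nonempty s] [s.direction.HasOrthogonalProjection] {z z' : P} (hmem : z' ∈ s)
    (hnear : ∀ y ∈ s, dist z z' ≤ dist z y) :
    (EuclideanGeometry.orthogonalProjection s z : P) = z' := by
  have hpyth :=
    EuclideanGeometry.dist_sq_eq_dist_orthogonalProjection_sq_add_dist_orthogonalProjection_sq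
      z hmem
  have hle := hnear _ (EuclideanGeometry.orthogonalProjection_mem (s := s) z)
  rw [dist_comm z' z] at hpyth
  have hzero : dist z' (EuclideanGeometry.orthogonalProjection s z : P) = 0 := by
    nlinarith [mul_self_le_mul_self dist_nonneg hle,
      dist_nonneg (x := z') (y := (EuclideanGeometry.orthogonalProjection s z : P))]
  exact (dist_eq_zero.mp hzero).symm

/-- A point in the convex hull of an injective finite family is a convex combination of it. -/
theorem exists_weights_of_mem_convexHull_range {ι E : Type*} [Fintype ι] [AddCommGroup E]
    [Module ℝ E] {q : ι → E} (hq : Function.Injective q) {y : E}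
    (hy : y ∈ convexHull ℝ (Set.range q)) :
    ∃ w : ι → ℝ, (∀ j, 0 ≤ w j) ∧ ∑ j, w j = 1 ∧ ∑ j, w j • q j = y := by
  classical
  have hrange : Set.range q = ((Finset.univ.image q : Finset E) : Set E) := by simp
  rw [hrange, Finset.mem_convexHull'] at hy
  obtain ⟨w, hw0, hw1, hwy⟩ := hy
  rw [Finset.sum_image hq.injOn] at hw1 hwy
  exact ⟨fun j => w (q j), fun j => hw0 _ (by simp), hw1, hwy⟩

/-- A convex combination of an injective family not using `q i` lies in the convex hull of the
other points. -/
theorem sum_smul_mem_convexHull_range_diff {ι E : Type*} [Fintype ι] [AddCommGroup E]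
    [Module ℝ E] {q : ι → E} (hq : Function.Injective q) {w : ι → ℝ} (hw0 : ∀ j, 0 ≤ w j)
    (hw1 : ∑ j, w j = 1) {i : ι} (hi : w i = 0) :
    ∑ j, w j • q j ∈ convexHull ℝ (Set.range q \ {q i}) := by
  classical
  rw [← Finset.sum_erase Finset.univ (a := i) (by simp [hi])]
  refine (convex_convexHull ℝ _).sum_mem (fun j _ => hw0 j) ?_ fun j hj => ?_
  · rwa [Finset.sum_erase _ hi]
  · exact subset_convexHull ℝ _ ⟨⟨j, rfl⟩, fun h => Finset.ne_of_mem_erase hj (hq h)⟩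


/-- Case 1 of Theorem 1 of the paper: if the affine coordinates (with respect to
`S' = {p₁,…}`) of the projections `x'` of `x` and `p'` of `p` onto `aff S'` both vanish
at index `k`, then `x` lies in the facet `conv ((S' \ {p_k}) ∪ {p})`. -/
theorem stmt10 {n k : ℕ} (q : Fin (k + 1) → EuclideanSpace ℝ (Fin n))
    (p : EuclideanSpace ℝ (Fin n))
    (hindep : AffineIndependent ℝ (Fin.snoc q p : Fin (k + 2) → EuclideanSpace ℝ (Fin n)))
    (x : EuclideanSpace ℝ (Fin n))
    (hx : x ∈ convexHull ℝ (Set.range q ∪ {p}))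
    (x' p' : EuclideanSpace ℝ (Fin n))
    (hx'mem : x' ∈ affineSpan ℝ (Set.range q))
    (hx'near : ∀ y ∈ affineSpan ℝ (Set.range q), dist x x' ≤ dist x y)
    (hp'mem : p' ∈ affineSpan ℝ (Set.range q))
    (hp'near : ∀ y ∈ affineSpan ℝ (Set.range q), dist p p' ≤ dist p y)
    (π ω : Fin (k + 1) → ℝ)
    (hπ1 : ∑ j, π j = 1) (hω1 : ∑ j, ω j = 1)
    (hx'eq : x' = ∑ j, π j • q j) (hp'eq : p' = ∑ j, ω j • q j)
    (kk : Fin (k + 1)) (hπk : π kk = 0) (hωk : ω kk = 0) :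
    x ∈ convexHull ℝ ((Set.range q \ {q kk}) ∪ {p}) := by
  have hq : AffineIndependent ℝ q := by
    simpa [Function.comp_def] using hindep.comp_embedding Fin.castSuccEmb
  have : Nonempty (affineSpan ℝ (Set.range q)) := ⟨⟨x', hx'mem⟩⟩
  rw [Set.union_singleton, convexHull_insert (Set.range_nonempty q), mem_convexJoin] at hx
  obtain ⟨p₀, hp₀, y, hy, a, b, ha, hb, hab, rfl⟩ := hx
  rw [Set.mem_singleton_iff] at hp₀
  subst p₀
  obtain ⟨w, hw0, hw1, rfl⟩ := exists_weights_of_mem_convexHull_range hq.injective hy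
  have hyspan := convexHull_subset_affineSpan _ hy
  have hproj : x' = a • p' + b • ∑ j, w j • q j := by
    rw [← eq_orthogonalProjection_of_forall_dist_le hx'mem hx'near,
      ← eq_orthogonalProjection_of_forall_dist_le hp'mem hp'near]
    have h := Convex.combo_affine_apply hab
      (f := (affineSpan ℝ (Set.range q)).subtype.comp
        (EuclideanGeometry.orthogonalProjection (affineSpan ℝ (Set.range q))).toAffineMap)
      (x := p) (y := ∑ j, w j • q j)
    have hy' := EuclideanGeometry.orthogonalProjection_eq_self_iff.mpr hyspan
    simpa [hy'] using h
  have hcoord : b * w kk = 0 := by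
    have h := affineIndependent_iff.mp hq Finset.univ (fun j => a * ω j + b * w j - π j)
      (by rw [Finset.sum_sub_distrib, Finset.sum_add_distrib, ← Finset.mul_sum, ← Finset.mul_sum,
            hω1, hw1, hπ1]; linarith)
      (by
        simp only [sub_smul, add_smul, mul_smul, Finset.sum_sub_distrib, Finset.sum_add_distrib,
          ← Finset.smul_sum]
        rw [← hp'eq, ← hx'eq, ← hproj, sub_self]) kk (Finset.mem_univ _)
    simpa [hπk, hωk] using h
  have hp : p ∈ convexHull ℝ ((Set.range q \ {q kk}) ∪ {p}) :=
    subset_convexHull ℝ _ (Or.inr rfl)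
  rcases mul_eq_zero.mp hcoord with h | h
  · obtain rfl : a = 1 := by linarith
    simpa [h] using hp
  · exact convex_convexHull ℝ _ hp
      (convexHull_mono Set.subset_union_left
        (sum_smul_mem_convexHull_range_diff hq.injective hw0 hw1 h)) ha hb hab
end

section
/- Let p_1, …, p_{s−1} be affinely independent points in ℝⁿ, and let x' = Σ_j π_j p_j with Σ_j π_j = 1 and p' = Σ_j ω_j p_j with Σ_j ω_j = 1 be points of their affine span written in affine coordinates. Assume π_j ≥ 0 for every j. Then the set {j : ω_j > 0} is nonempty, and for any index k₁ attaining the minimum of π_j/ω_j over {j : ω_j > 0}, the point x' lies in the convex hull of ({p_1, …, p_{s−1}} \ {p_{k₁}}) ∪ {p'}. -/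
/-- Case 2 of Theorem 1 of the paper, when all `πⱼ ≥ 0`: the set `{j : ωⱼ > 0}` is
nonempty, and for any `k₁` minimizing `πⱼ/ωⱼ` over it, `x'` lies in
`conv (({p₁,…} \ {p_{k₁}}) ∪ {p'})`. -/
theorem stmt11 {n m : ℕ} (p : Fin m → EuclideanSpace ℝ (Fin n))
    (hindep : AffineIndependent ℝ p)
    (π ω : Fin m → ℝ) (hπ1 : ∑ j, π j = 1) (hω1 : ∑ j, ω j = 1)
    (x' p' : EuclideanSpace ℝ (Fin n))
    (hx' : x' = ∑ j, π j • p j) (hp' : p' = ∑ j, ω j • p j)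
    (hπnn : ∀ j, 0 ≤ π j) :
    (∃ j, 0 < ω j) ∧
      ∀ k₁ : Fin m, 0 < ω k₁ → (∀ j, 0 < ω j → π k₁ / ω k₁ ≤ π j / ω j) →
        x' ∈ convexHull ℝ ((Set.range p \ {p k₁}) ∪ {p'}) := by
  refine ⟨?_, fun k₁ hk hmin => ?_⟩
  · by_contra! h
    linarith [Finset.sum_nonpos fun j (_ : j ∈ Finset.univ) => h j]
  · set t := π k₁ / ω k₁ with ht
    have ht0 : 0 ≤ t := div_nonneg (hπnn k₁) hk.le
    have hcoeff : ∀ j, 0 ≤ π j - t * ω j := by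
      intro j
      rcases lt_or_ge 0 (ω j) with hj | hj
      · exact sub_nonneg.2 ((le_div_iff₀ hj).1 (hmin j hj))
      · linarith [hπnn j, mul_nonpos_of_nonneg_of_nonpos ht0 hj]
    have hcoeff_k₁ : π k₁ - t * ω k₁ = 0 := by
      rw [ht, div_mul_cancel₀ _ hk.ne', sub_self]
    let w : Option (Fin m) → ℝ := fun o => o.elim t fun j => π j - t * ω j
    let z : Option (Fin m) → EuclideanSpace ℝ (Fin n) :=
      fun o => o.elim p' fun j => if j = k₁ then p' else p j
    have hw : ∑ o, w o = 1 := by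
      simp [w, Fintype.sum_option, Finset.sum_sub_distrib, ← Finset.mul_sum, hπ1, hω1]
    have hterm : ∀ j, (π j - t * ω j) • (if j = k₁ then p' else p j)
        = π j • p j - t • ω j • p j := by
      intro j
      rw [smul_smul, ← sub_smul]
      split_ifs with hj
      · simp [hj, hcoeff_k₁]
      · rfl
    have hx : x' = ∑ o, w o • z o := by
      simp [w, z, Fintype.sum_option, hterm, Finset.sum_sub_distrib, ← Finset.smul_sum,
        ← hx', ← hp']
    rw [hx]
    refine (convex_convexHull ℝ _).sum_mem ?_ hw fun o _ => subset_convexHull ℝ _ ?_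
    · rintro (_ | j) _
      exacts [ht0, hcoeff j]
    · rcases o with _ | j
      · simp [z]
      · by_cases hj : j = k₁
        · simp [z, hj]
        · simp [z, hj, hindep.injective.eq_iff]
end

section
/- Let p_1, …, p_{s−1} be affinely independent points in ℝⁿ, and let x' = Σ_j π_j p_j with Σ_j π_j = 1 and p' = Σ_j ω_j p_j with Σ_j ω_j = 1 be points of their affine span written in affine coordinates. Assume x' lies in the convex hull of {p_1, …, p_{s−1}} ∪ {p'} and that π_j < 0 for some index j. Then the sets J₊ = {j : π_j ≥ 0, ω_j > 0} and J₋ = {j : π_j ≤ 0, ω_j < 0} are both nonempty; for any k₁ attaining the minimum of π_j/ω_j over J₊ and any k₂ attaining the maximum of π_j/ω_j over J₋, one has k₁ ≠ k₂, π_{k₂}/ω_{k₂} ≤ π_{k₁}/ω_{k₁}, and x' lies both in the convex hull of ({p_1, …, p_{s−1}} \ {p_{k₁}}) ∪ {p'} and in the convex hull of ({p_1, …, p_{s−1}} \ {p_{k₂}}) ∪ {p'}. -/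
/-- A point of the convex hull of a finite family together with a point `q` is a convex
combination of the members of the family and `q`. -/
theorem exists_weights_of_mem_convexHull_range_union_singleton {ι E : Type*} [Fintype ι]
    [AddCommGroup E] [Module ℝ E] {p : ι → E} {q x : E}
    (hx : x ∈ convexHull ℝ (Set.range p ∪ {q})) :
    ∃ (c : ι → ℝ) (t : ℝ), (∀ j, 0 ≤ c j) ∧ 0 ≤ t ∧ ∑ j, c j + t = 1 ∧
      x = ∑ j, c j • p j + t • q := by
  classical
  refine convexHull_min (t := {x | ∃ (c : ι → ℝ) (t : ℝ), (∀ j, 0 ≤ c j) ∧ 0 ≤ t ∧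
    ∑ j, c j + t = 1 ∧ x = ∑ j, c j • p j + t • q}) ?_ ?_ hx
  · rintro y (⟨i, rfl⟩ | rfl)
    · refine ⟨Pi.single i 1, 0, fun j => ?_, le_rfl, by simp, ?_⟩
      · by_cases h : j = i
        · subst h; simp
        · simp [h]
      · simp [Pi.single_apply, ite_smul]
    · exact ⟨0, 1, by simp, zero_le_one, by simp, by simp⟩
  · rintro _ ⟨c, t, hc, ht, hsum, rfl⟩ _ ⟨d, s, hd, hs, hsum', rfl⟩ a b ha hb hab
    refine ⟨fun j => a * c j + b * d j, a * t + b * s, fun j => ?_, by positivity, ?_, ?_⟩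
    · have := hc j
      have := hd j
      positivity
    · rw [Finset.sum_add_distrib, ← Finset.mul_sum, ← Finset.mul_sum]
      linear_combination a * hsum + b * hsum' + hab
    · simp only [smul_add, Finset.smul_sum, add_smul, mul_smul, Finset.sum_add_distrib]
      abel

/-- A convex combination in which the weight of `p k` vanishes lies in the convex hull of the
remaining points. -/
theorem sum_add_smul_mem_convexHull_diff_singleton {ι E : Type*} [Fintype ι]
    [AddCommGroup E] [Module ℝ E] {p : ι → E} (hp : Function.Injective p) {q : E} {c : ι → ℝ}
    {t : ℝ} {k : ι} (hc : ∀ j, 0 ≤ c j) (hk : c k = 0) (ht : 0 ≤ t)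
    (hsum : ∑ j, c j + t = 1) :
    ∑ j, c j • p j + t • q ∈ convexHull ℝ ((Set.range p \ {p k}) ∪ {q}) := by
  classical
  have h := (convex_convexHull ℝ ((Set.range p \ {p k}) ∪ {q})).sum_mem
    (t := Finset.insertNone (Finset.univ.erase k)) (w := fun o => o.elim t c)
    (z := fun o => o.elim q p) ?_ ?_ ?_
  · rw [Finset.sum_insertNone] at h
    simp only [Option.elim] at h
    rwa [Finset.sum_erase _ (by simp [hk]), add_comm] at h
  · rintro (_ | j) _
    · exact ht
    · exact hc j
  · rw [Finset.sum_insertNone]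
    simp only [Option.elim]
    rw [Finset.sum_erase _ hk, add_comm, hsum]
  · rintro (_ | j) hj
    · exact subset_convexHull ℝ _ (Or.inr rfl)
    · have hjk : j ≠ k := by simpa using hj
      exact subset_convexHull ℝ _ (Or.inl ⟨⟨j, rfl⟩, fun h => hjk (hp h)⟩)

/-- If the affine coordinates of a point dominate `r` times those of another one, with equality
at `k`, then the first point lies in the convex hull of the second one and the basis points other
than `p k`. -/
theorem sum_smul_mem_convexHull_diff_singleton {ι E : Type*} [Fintype ι]
    [AddCommGroup E] [Module ℝ E] {p : ι → E} (hp : Function.Injective p) {a b : ι → ℝ}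
    (ha : ∑ j, a j = 1) (hb : ∑ j, b j = 1) {r : ℝ} {k : ι} (hr : 0 ≤ r)
    (hle : ∀ j, r * b j ≤ a j) (hk : a k = r * b k) :
    ∑ j, a j • p j ∈ convexHull ℝ ((Set.range p \ {p k}) ∪ {∑ j, b j • p j}) := by
  have h := sum_add_smul_mem_convexHull_diff_singleton hp (q := ∑ j, b j • p j)
    (c := fun j => a j - r * b j) (t := r) (k := k) (fun j => sub_nonneg.2 (hle j))
    (sub_eq_zero.2 hk) hr (by rw [Finset.sum_sub_distrib, ← Finset.mul_sum, ha, hb]; ring)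
  simpa [sub_smul, Finset.smul_sum, mul_smul] using h

/-- If a point lies in the convex hull of an affinely independent family and a further point, then
its affine coordinates dominate a nonnegative multiple of those of the further point. -/
theorem AffineIndependent.exists_nonneg_mul_le {ι E : Type*} [Fintype ι]
    [AddCommGroup E] [Module ℝ E] {p : ι → E} (hp : AffineIndependent ℝ p) {a b : ι → ℝ}
    (ha : ∑ j, a j = 1) (hb : ∑ j, b j = 1)
    (h : ∑ j, a j • p j ∈ convexHull ℝ (Set.range p ∪ {∑ j, b j • p j})) :
    ∃ t : ℝ, 0 ≤ t ∧ ∀ j, t * b j ≤ a j := by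
  obtain ⟨c, t, hc, ht, hsum, hx⟩ := exists_weights_of_mem_convexHull_range_union_singleton h
  refine ⟨t, ht, fun j => ?_⟩
  have hcoord := affineIndependent_iff.1 hp Finset.univ (fun j => a j - (c j + t * b j))
    (by
      rw [Finset.sum_sub_distrib, Finset.sum_add_distrib, ← Finset.mul_sum, ha, hb]
      linear_combination -hsum)
    (by
      simp only [sub_smul, add_smul, mul_smul, Finset.sum_sub_distrib, Finset.sum_add_distrib,
        ← Finset.smul_sum]
      rw [hx, sub_self])
    j (Finset.mem_univ j)
  linarith [hc j]


/-- Case 2 of Theorem 1 of the paper, when some `πⱼ < 0`: both index sets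
`J₊ = {j : πⱼ ≥ 0, ωⱼ > 0}` and `J₋ = {j : πⱼ ≤ 0, ωⱼ < 0}` are nonempty, and for `k₁`
minimizing `πⱼ/ωⱼ` over `J₊` and `k₂` maximizing it over `J₋`, one has `k₁ ≠ k₂`,
`π_{k₂}/ω_{k₂} ≤ π_{k₁}/ω_{k₁}`, and `x'` lies in both corresponding projected facets. -/
theorem stmt12 {n m : ℕ} (p : Fin m → EuclideanSpace ℝ (Fin n))
    (hindep : AffineIndependent ℝ p)
    (π ω : Fin m → ℝ) (hπ1 : ∑ j, π j = 1) (hω1 : ∑ j, ω j = 1)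
    (x' p' : EuclideanSpace ℝ (Fin n))
    (hx' : x' = ∑ j, π j • p j) (hp' : p' = ∑ j, ω j • p j)
    (hconv : x' ∈ convexHull ℝ (Set.range p ∪ {p'}))
    (hneg : ∃ j, π j < 0) :
    (∃ j, 0 ≤ π j ∧ 0 < ω j) ∧ (∃ j, π j ≤ 0 ∧ ω j < 0) ∧
      ∀ k₁ k₂ : Fin m,
        (0 ≤ π k₁ ∧ 0 < ω k₁ ∧ ∀ j, 0 ≤ π j → 0 < ω j → π k₁ / ω k₁ ≤ π j / ω j) →
        (π k₂ ≤ 0 ∧ ω k₂ < 0 ∧ ∀ j, π j ≤ 0 → ω j < 0 → π j / ω j ≤ π k₂ / ω k₂) →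
        k₁ ≠ k₂ ∧ π k₂ / ω k₂ ≤ π k₁ / ω k₁ ∧
          x' ∈ convexHull ℝ ((Set.range p \ {p k₁}) ∪ {p'}) ∧
          x' ∈ convexHull ℝ ((Set.range p \ {p k₂}) ∪ {p'}) := by
  subst hx' hp'
  obtain ⟨t, ht, hle⟩ := hindep.exists_nonneg_mul_le hπ1 hω1 hconv
  have hinj := hindep.injective
  have hpos : ∃ j, 0 < ω j := by
    by_contra! h
    linarith [Finset.sum_nonpos fun j (_ : j ∈ Finset.univ) => h j]
  obtain ⟨i, hi⟩ := hneg
  obtain ⟨l, hl⟩ := hpos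
  refine ⟨⟨l, (mul_nonneg ht hl.le).trans (hle l), hl⟩, ⟨i, hi.le, ?_⟩, ?_⟩
  · by_contra! h
    linarith [mul_nonneg ht h, hle i]
  rintro k₁ k₂ ⟨hπk₁, hωk₁, hmin⟩ ⟨hπk₂, hωk₂, hmax⟩
  have hk₁ : t ≤ π k₁ / ω k₁ := (le_div_iff₀ hωk₁).2 (hle k₁)
  have hk₂ : π k₂ / ω k₂ ≤ t := (div_le_iff_of_neg hωk₂).2 (hle k₂)
  have hk₂_nonneg : 0 ≤ π k₂ / ω k₂ := div_nonneg_of_nonpos hπk₂ hωk₂.le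
  refine ⟨?_, hk₂.trans hk₁, ?_, ?_⟩
  · rintro rfl
    exact lt_asymm hωk₁ hωk₂
  · refine sum_smul_mem_convexHull_diff_singleton hinj hπ1 hω1 (ht.trans hk₁) (fun j => ?_)
      (div_mul_cancel₀ _ hωk₁.ne').symm
    rcases le_or_gt (ω j) 0 with hj | hj
    · exact (mul_le_mul_of_nonpos_right hk₁ hj).trans (hle j)
    · exact (le_div_iff₀ hj).1 (hmin j ((mul_nonneg ht hj.le).trans (hle j)) hj)
  · refine sum_smul_mem_convexHull_diff_singleton hinj hπ1 hω1 hk₂_nonneg (fun j => ?_)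
      (div_mul_cancel₀ _ hωk₂.ne).symm
    rcases le_or_gt 0 (ω j) with hj | hj
    · exact (mul_le_mul_of_nonneg_right hk₂ hj).trans (hle j)
    rcases le_or_gt (π j) 0 with hπj | hπj
    · exact (div_le_iff_of_neg hj).1 (hmax j hπj hj)
    · exact (mul_nonpos_of_nonneg_of_nonpos hk₂_nonneg hj.le).trans hπj.le
end

section
/- Let p_1, …, p_m be points in ℝⁿ and let π_1, …, π_m be nonnegative real numbers with Σ_i π_i = 1. If the ball B(x,r) covers {p_1, …, p_m}, then Σ_i π_i ‖p_i‖² − ‖Σ_i π_i p_i‖² ≤ r². (Weak duality between the minimum covering ball problem and its Lagrangian dual.) -/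
/-- The weighted second moment about `x` equals the variance plus the squared distance from
`x` to the weighted mean. -/
theorem sum_mul_norm_sub_sq_eq {ι E : Type*} [NormedAddCommGroup E] [InnerProductSpace ℝ E]
    (s : Finset ι) (p : ι → E) (w : ι → ℝ) (hw : ∑ i ∈ s, w i = 1) (x : E) :
    ∑ i ∈ s, w i * ‖p i - x‖ ^ 2 =
      (∑ i ∈ s, w i * ‖p i‖ ^ 2) - ‖∑ i ∈ s, w i • p i‖ ^ 2 + ‖(∑ i ∈ s, w i • p i) - x‖ ^ 2 := by
  have hinner : inner ℝ (∑ i ∈ s, w i • p i) x = ∑ i ∈ s, w i * inner ℝ (p i) x := by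
    simp only [sum_inner, real_inner_smul_left]
  have hsum : ∑ i ∈ s, w i * ‖p i - x‖ ^ 2 =
      (∑ i ∈ s, w i * ‖p i‖ ^ 2) - 2 * (∑ i ∈ s, w i * inner ℝ (p i) x)
        + (∑ i ∈ s, w i) * ‖x‖ ^ 2 := by
    rw [Finset.mul_sum, Finset.sum_mul, ← Finset.sum_sub_distrib, ← Finset.sum_add_distrib]
    refine Finset.sum_congr rfl fun i _ => ?_
    rw [norm_sub_sq_real]
    ring
  rw [hsum, hw, norm_sub_sq_real, hinner]
  ring

/-- Weak duality for the minimum covering ball problem: any dual feasible `π` gives a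
lower bound on the squared radius of any covering ball. -/
theorem stmt13 {n m : ℕ} (p : Fin m → EuclideanSpace ℝ (Fin n))
    (π : Fin m → ℝ) (hπnn : ∀ i, 0 ≤ π i) (hπ1 : ∑ i, π i = 1)
    (x : EuclideanSpace ℝ (Fin n)) (r : ℝ)
    (hcov : ∀ i, ‖p i - x‖ ≤ r) :
    (∑ i, π i * ‖p i‖ ^ 2) - ‖∑ i, π i • p i‖ ^ 2 ≤ r ^ 2 := by
  have hmoment := sum_mul_norm_sub_sq_eq Finset.univ p π hπ1 x
  have hbound : ∑ i, π i * ‖p i - x‖ ^ 2 ≤ r ^ 2 :=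
    calc ∑ i, π i * ‖p i - x‖ ^ 2 ≤ ∑ i, π i * r ^ 2 :=
          Finset.sum_le_sum fun i _ => mul_le_mul_of_nonneg_left
            (pow_le_pow_left₀ (norm_nonneg _) (hcov i) 2) (hπnn i)
      _ = r ^ 2 := by rw [← Finset.sum_mul, hπ1, one_mul]
  linarith [sq_nonneg ‖(∑ i, π i • p i) - x‖]
end

section
/- Let P be a nonempty finite set of points in Euclidean space ℝⁿ. If B(x,r) and B(y,r) are both minimum covering balls of P (in particular, they have the same radius r), then x = y; that is, the center of the minimum covering ball of P is unique. -/
/-- Uniqueness of the center of the minimum covering ball: if `B(x,r)` and `B(y,r)` are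
both minimum covering balls of a nonempty finite set `P`, then `x = y`. -/
theorem stmt14 {n : ℕ} (P : Finset (EuclideanSpace ℝ (Fin n))) (hP : P.Nonempty)
    (x y : EuclideanSpace ℝ (Fin n)) (r : ℝ)
    (hx : ∀ p ∈ P, ‖p - x‖ ≤ r) (hy : ∀ p ∈ P, ‖p - y‖ ≤ r)
    (hmin : ∀ (z : EuclideanSpace ℝ (Fin n)) (r' : ℝ), (∀ p ∈ P, ‖p - z‖ ≤ r') → r ≤ r') :
    x = y := by
  by_contra hne
  obtain ⟨p, hp, hmax⟩ := P.exists_max_image (fun p => ‖p - midpoint ℝ x y‖) hP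
  refine (hmin (midpoint ℝ x y) _ hmax).not_gt ?_
  have h := norm_combo_lt_of_ne (hx p hp) (hy p hp) (fun h => hne (sub_right_injective h))
    (by norm_num : (0 : ℝ) < 1 / 2) (by norm_num : (0 : ℝ) < 1 / 2) (by norm_num)
  have hmid : p - midpoint ℝ x y = (1 / 2 : ℝ) • (p - x) + (1 / 2 : ℝ) • (p - y) := by
    rw [midpoint_eq_smul_add, invOf_eq_inv]
    module
  rwa [← hmid] at h
end
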